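/- Let q ≥ 2 be a real number, m ≥ 1 an integer, n = m + 2, and let B ∈ ℝ^{m×n} be the matrix whose i-th row (written as a vector r_i^B ∈ ℝ^n) is r_i^B = (1 − m^{−2/q})^{1/2} e_i + m^{−1/q} e_n for i = 1,…,m, where e_1,…,e_n are the standard basis vectors of ℝ^n. Then every row of B has unit 2-norm, ‖B‖_{2→∞} = 1, ‖B‖_{2→2} ≥ ‖B e_n‖_2 = m^{1/2 − 1/q}, and ‖B‖_{2→q} ≤ 2. -/

import Mathlib

open scoped BigOperators

/-- The `ℓ_p` norm of a vector, for a real exponent `p`. -/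
noncomputable def lpnorm {n : ℕ} {𝕜 : Type*} [RCLike 𝕜] (p : ℝ) (x : Fin n → 𝕜) : ℝ :=
  (∑ i, ‖x i‖ ^ p) ^ (1 / p)

/-- The `ℓ_∞` norm of a vector. -/
noncomputable def linorm {n : ℕ} {𝕜 : Type*} [RCLike 𝕜] (x : Fin n → 𝕜) : ℝ :=
  ⨆ i, ‖x i‖

/-- The `p → q` operator norm of a matrix: `max_{x ≠ 0} ‖Ax‖_q / ‖x‖_p`. -/
noncomputable def opNorm {m n : ℕ} {𝕜 : Type*} [RCLike 𝕜] (p q : ℝ)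
    (A : Matrix (Fin m) (Fin n) 𝕜) : ℝ :=
  ⨆ x : {x : Fin n → 𝕜 // x ≠ 0}, lpnorm q (A.mulVec x.1) / lpnorm p x.1

/-- The `p → ∞` operator norm of a matrix: `max_{x ≠ 0} ‖Ax‖_∞ / ‖x‖_p`. -/
noncomputable def opNormInf {m n : ℕ} {𝕜 : Type*} [RCLike 𝕜] (p : ℝ)
    (A : Matrix (Fin m) (Fin n) 𝕜) : ℝ :=
  ⨆ x : {x : Fin n → 𝕜 // x ≠ 0}, linorm (A.mulVec x.1) / lpnorm p x.1

/-- `row A i` is the conjugate transpose of the `i`-th row of `A`,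
so that `(A x) i = ⟨x, row A i⟩` for the standard Hermitian inner product. -/
def row {m n : ℕ} {𝕜 : Type*} [RCLike 𝕜] (A : Matrix (Fin m) (Fin n) 𝕜) (i : Fin m) :
    Fin n → 𝕜 := fun k => star (A i k)

/-- The standard Hermitian inner product `⟨x, y⟩ = ∑ k, x k * conj (y k)`. -/
noncomputable def hinner {n : ℕ} (x y : Fin n → ℂ) : ℂ := ∑ k, x k * star (y k)

theorem lpnorm_nonneg {n : ℕ} (p : ℝ) (x : Fin n → ℝ) : 0 ≤ lpnorm p x := by
  unfold lpnorm; positivity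

theorem lpnorm_two_sq {n : ℕ} (x : Fin n → ℝ) : lpnorm 2 x ^ 2 = ∑ k, x k ^ 2 := by
  have h : lpnorm 2 x = √(∑ k, x k ^ 2) := by
    simp [lpnorm, Real.sqrt_eq_rpow]
  rw [h, Real.sq_sqrt (Finset.sum_nonneg fun k _ => sq_nonneg _)]

theorem lpnorm_two_pos {n : ℕ} {x : Fin n → ℝ} (hx : x ≠ 0) : 0 < lpnorm 2 x := by
  obtain ⟨k, hk⟩ := Function.ne_iff.mp hx
  have h : 0 < ∑ k, x k ^ 2 :=
    Finset.sum_pos' (fun k _ => sq_nonneg _) ⟨k, Finset.mem_univ k, by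
      have : x k ≠ 0 := hk
      positivity⟩
  rw [← lpnorm_two_sq] at h
  exact lt_of_le_of_ne (lpnorm_nonneg 2 x) fun h0 => by simp [← h0] at h

theorem abs_le_lpnorm_two {n : ℕ} (x : Fin n → ℝ) (k : Fin n) : |x k| ≤ lpnorm 2 x := by
  refine abs_le_of_sq_le_sq (?_ : x k ^ 2 ≤ lpnorm 2 x ^ 2) (lpnorm_nonneg 2 x)
  rw [lpnorm_two_sq]
  exact Finset.single_le_sum (f := fun k => x k ^ 2) (fun k _ => sq_nonneg _) (Finset.mem_univ k)

theorem sq_add_sq_le_lpnorm_two_sq {n : ℕ} (x : Fin n → ℝ) {k l : Fin n} (hkl : k ≠ l) :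
    x k ^ 2 + x l ^ 2 ≤ lpnorm 2 x ^ 2 := by
  rw [lpnorm_two_sq, ← Finset.sum_pair (f := fun k => x k ^ 2) hkl]
  exact Finset.sum_le_sum_of_subset_of_nonneg (Finset.subset_univ _) fun k _ _ => sq_nonneg _

/-- The `ℓ_q` norm is dominated by the `ℓ_2` norm for `q ≥ 2`. -/
theorem lpnorm_le_lpnorm_two {n : ℕ} {q : ℝ} (hq : 2 ≤ q) (x : Fin n → ℝ) :
    lpnorm q x ≤ lpnorm 2 x := by
  have hN := lpnorm_nonneg 2 x
  have hq0 : 0 < q := by linarith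
  have hpow : ∀ y : ℝ, 0 ≤ y → y ^ q = y ^ (q - 2) * y ^ 2 := fun y hy => by
    rw [← Real.rpow_natCast y 2, ← Real.rpow_add_of_nonneg hy (by linarith) (by norm_num)]
    norm_num
  have h : ∑ k, ‖x k‖ ^ q ≤ lpnorm 2 x ^ q := by
    rw [hpow _ hN, lpnorm_two_sq x, Finset.mul_sum]
    refine Finset.sum_le_sum fun k _ => ?_
    rw [hpow _ (norm_nonneg _), Real.norm_eq_abs, sq_abs]
    exact mul_le_mul_of_nonneg_right
      (Real.rpow_le_rpow (abs_nonneg _) (abs_le_lpnorm_two x k) (by linarith)) (sq_nonneg _)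
  calc lpnorm q x ≤ (lpnorm 2 x ^ q) ^ (1 / q) :=
        Real.rpow_le_rpow (by positivity) h (by positivity)
    _ = lpnorm 2 x := by
        rw [one_div, Real.rpow_rpow_inv hN hq0.ne']

theorem lpnorm_two_comp_le {m n : ℕ} {f : Fin m → Fin n} (hf : Function.Injective f)
    (x : Fin n → ℝ) : lpnorm 2 (fun i => x (f i)) ≤ lpnorm 2 x := by
  refine le_of_sq_le_sq ?_ (lpnorm_nonneg 2 x)
  rw [lpnorm_two_sq, lpnorm_two_sq,
    ← Finset.sum_image (f := fun k => x k ^ 2) (g := f) (s := Finset.univ) hf.injOn]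
  exact Finset.sum_le_sum_of_subset_of_nonneg (Finset.subset_univ _) fun k _ _ => sq_nonneg _

theorem lpnorm_const {m : ℕ} {q : ℝ} (hq : 0 < q) (c : ℝ) :
    lpnorm q (fun _ : Fin m => c) = (m : ℝ) ^ (1 / q) * |c| := by
  simp only [lpnorm, Finset.sum_const, Finset.card_univ, Fintype.card_fin, nsmul_eq_mul,
    Real.norm_eq_abs]
  rw [Real.mul_rpow (by positivity) (by positivity), one_div,
    Real.rpow_rpow_inv (abs_nonneg c) hq.ne']

/-- The matrix with rows `s • e_i + t • e_{m+2}`. -/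
def spikeMatrix (m : ℕ) (s t : ℝ) : Matrix (Fin m) (Fin (m + 2)) ℝ :=
  Matrix.of fun (i : Fin m) (k : Fin (m + 2)) =>
    if (k : ℕ) = (i : ℕ) then s else if (k : ℕ) = m + 1 then t else 0

namespace spikeMatrix

variable {m : ℕ} {s t : ℝ}

theorem castAdd_ne_last (i : Fin m) : Fin.castAdd 2 i ≠ Fin.last (m + 1) := by
  intro h
  have := congrArg Fin.val h
  simp at this
  omega

theorem apply_castAdd (i : Fin m) : spikeMatrix m s t i (Fin.castAdd 2 i) = s := by
  simp [spikeMatrix]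

theorem apply_last (i : Fin m) : spikeMatrix m s t i (Fin.last (m + 1)) = t := by
  have : m + 1 ≠ (i : ℕ) := by omega
  simp [spikeMatrix, this]

theorem apply_eq_zero {i : Fin m} {k : Fin (m + 2)} (h₁ : k ≠ Fin.castAdd 2 i)
    (h₂ : k ≠ Fin.last (m + 1)) : spikeMatrix m s t i k = 0 := by
  have h₁' : (k : ℕ) ≠ i := fun h => h₁ (Fin.ext h)
  have h₂' : (k : ℕ) ≠ m + 1 := fun h => h₂ (Fin.ext h)
  simp [spikeMatrix, h₁', h₂']

theorem mulVec_apply (x : Fin (m + 2) → ℝ) (i : Fin m) :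
    (spikeMatrix m s t).mulVec x i = s * x (Fin.castAdd 2 i) + t * x (Fin.last (m + 1)) := by
  rw [Matrix.mulVec, dotProduct, Fintype.sum_eq_add _ _ (castAdd_ne_last i), apply_castAdd,
    apply_last]
  rintro k ⟨h₁, h₂⟩
  rw [apply_eq_zero h₁ h₂, zero_mul]

theorem lpnorm_two_row (hst : s ^ 2 + t ^ 2 = 1) (i : Fin m) :
    lpnorm 2 (fun k => spikeMatrix m s t i k) = 1 := by
  rw [← sq_eq_sq₀ (lpnorm_nonneg 2 _) zero_le_one, lpnorm_two_sq,
    Fintype.sum_eq_add _ _ (castAdd_ne_last i), apply_castAdd, apply_last, hst, one_pow]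
  rintro k ⟨h₁, h₂⟩
  rw [apply_eq_zero h₁ h₂, zero_pow two_ne_zero]

theorem lpnorm_mulVec_le {q : ℝ} (hq : 2 ≤ q) (hs : |s| ≤ 1) (x : Fin (m + 2) → ℝ) :
    lpnorm q ((spikeMatrix m s t).mulVec x) ≤ (1 + (m : ℝ) ^ (1 / q) * |t|) * lpnorm 2 x := by
  have hN := lpnorm_nonneg 2 x
  have h₁ : lpnorm q ((spikeMatrix m s t).mulVec x) ≤
      lpnorm q (fun i : Fin m => s * x (Fin.castAdd 2 i)) +
        lpnorm q (fun _ : Fin m => t * x (Fin.last (m + 1))) := by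
    simp only [lpnorm, mulVec_apply, Real.norm_eq_abs]
    exact Real.Lp_add_le _ _ _ (by linarith)
  have h₂ : lpnorm q (fun i : Fin m => s * x (Fin.castAdd 2 i)) ≤ lpnorm 2 x := by
    refine le_trans ?_ ((lpnorm_le_lpnorm_two hq _).trans
      (lpnorm_two_comp_le (Fin.castAdd_injective m 2) x))
    unfold lpnorm
    gcongr with i
    rw [norm_mul]
    exact mul_le_of_le_one_left (norm_nonneg _) hs
  rw [lpnorm_const (by linarith), abs_mul] at h₁
  have h₃ : (m : ℝ) ^ (1 / q) * (|t| * |x (Fin.last (m + 1))|) ≤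
      (m : ℝ) ^ (1 / q) * (|t| * lpnorm 2 x) := by
    gcongr
    exact abs_le_lpnorm_two x _
  linarith

theorem lpnorm_mulVec_div_le {q : ℝ} (hq : 2 ≤ q) (hs : |s| ≤ 1)
    (x : {x : Fin (m + 2) → ℝ // x ≠ 0}) :
    lpnorm q ((spikeMatrix m s t).mulVec x.1) / lpnorm 2 x.1 ≤ 1 + (m : ℝ) ^ (1 / q) * |t| :=
  (div_le_iff₀ (lpnorm_two_pos x.2)).mpr (lpnorm_mulVec_le hq hs x.1)

theorem opNorm_le {q : ℝ} (hq : 2 ≤ q) (hs : |s| ≤ 1) :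
    opNorm 2 q (spikeMatrix m s t) ≤ 1 + (m : ℝ) ^ (1 / q) * |t| :=
  Real.iSup_le (lpnorm_mulVec_div_le hq hs) (by positivity)

theorem lpnorm_two_last_le_opNorm (hs : |s| ≤ 1) :
    lpnorm 2 (fun i => spikeMatrix m s t i (Fin.last (m + 1))) ≤
      opNorm 2 2 (spikeMatrix m s t) := by
  have hne : (Pi.single (Fin.last (m + 1)) 1 : Fin (m + 2) → ℝ) ≠ 0 := by simp
  have hone : lpnorm 2 (Pi.single (Fin.last (m + 1)) 1 : Fin (m + 2) → ℝ) = 1 := by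
    rw [← sq_eq_sq₀ (lpnorm_nonneg 2 _) zero_le_one, lpnorm_two_sq]
    simp [Pi.single_apply]
  have h := le_ciSup (f := fun x : {x : Fin (m + 2) → ℝ // x ≠ 0} =>
    lpnorm 2 ((spikeMatrix m s t).mulVec x.1) / lpnorm 2 x.1)
    ⟨_, Set.forall_mem_range.mpr (lpnorm_mulVec_div_le le_rfl hs)⟩ ⟨_, hne⟩
  simp only [hone, div_one, Matrix.mulVec_single_one] at h
  exact h

theorem opNormInf_eq_one (hm : 1 ≤ m) (hst : s ^ 2 + t ^ 2 = 1) :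
    opNormInf 2 (spikeMatrix m s t) = 1 := by
  have hle : ∀ x : {x : Fin (m + 2) → ℝ // x ≠ 0},
      linorm ((spikeMatrix m s t).mulVec x.1) / lpnorm 2 x.1 ≤ 1 := fun x => by
    rw [div_le_one (lpnorm_two_pos x.2)]
    refine Real.iSup_le (fun i => ?_) (lpnorm_nonneg 2 _)
    rw [mulVec_apply, Real.norm_eq_abs]
    refine abs_le_of_sq_le_sq ?_ (lpnorm_nonneg 2 x.1)
    have h := sq_add_sq_le_lpnorm_two_sq x.1 (castAdd_ne_last i)
    set a := x.1 (Fin.castAdd 2 i)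
    set b := x.1 (Fin.last (m + 1))
    have : (s * a + t * b) ^ 2 + (s * b - t * a) ^ 2 = a ^ 2 + b ^ 2 := by
      linear_combination (a ^ 2 + b ^ 2) * hst
    nlinarith [sq_nonneg (s * b - t * a)]
  refine le_antisymm (Real.iSup_le hle zero_le_one) ?_
  let i : Fin m := ⟨0, hm⟩
  have hrow := lpnorm_two_row hst i
  have hne : (fun k => spikeMatrix m s t i k) ≠ 0 := fun h => by
    have h₁ : s = 0 := (apply_castAdd i).symm.trans (congrFun h _)
    have h₂ : t = 0 := (apply_last i).symm.trans (congrFun h _)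
    simp [h₁, h₂] at hst
  have h := le_ciSup (f := fun x : {x : Fin (m + 2) → ℝ // x ≠ 0} =>
    linorm ((spikeMatrix m s t).mulVec x.1) / lpnorm 2 x.1)
    ⟨_, Set.forall_mem_range.mpr hle⟩ ⟨_, hne⟩
  refine le_trans ?_ h
  simp only [hrow, div_one]
  have hi := le_ciSup (f := fun j => ‖(spikeMatrix m s t).mulVec (spikeMatrix m s t i) j‖)
    (Set.finite_range _).bddAbove i
  refine le_trans ?_ hi
  simp only [mulVec_apply, apply_castAdd, apply_last]
  rw [← sq, ← sq, hst, norm_one]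

end spikeMatrix

theorem stmt19 {m : ℕ} (hm : 1 ≤ m) (q : ℝ) (hq : 2 ≤ q)
    (B : Matrix (Fin m) (Fin (m + 2)) ℝ)
    (hB : B = Matrix.of fun (i : Fin m) (k : Fin (m + 2)) =>
      if (k : ℕ) = (i : ℕ) then Real.sqrt (1 - (m : ℝ) ^ (-(2 / q)))
      else if (k : ℕ) = m + 1 then (m : ℝ) ^ (-(1 / q))
      else 0) :
    (∀ i : Fin m, lpnorm 2 (fun k => B i k) = 1) ∧
      opNormInf 2 B = 1 ∧
      opNorm 2 2 B ≥ lpnorm 2 (fun i => B i (Fin.last (m + 1))) ∧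
      lpnorm 2 (fun i => B i (Fin.last (m + 1))) = (m : ℝ) ^ ((1 : ℝ) / 2 - 1 / q) ∧
      opNorm 2 q B ≤ 2 := by
  have hm' : (1 : ℝ) ≤ m := by exact_mod_cast hm
  have hm0 : (0 : ℝ) < m := by linarith
  have hq0 : 0 < q := by linarith
  change B = spikeMatrix m _ _ at hB
  set t : ℝ := (m : ℝ) ^ (-(1 / q)) with ht
  set s : ℝ := √(1 - (m : ℝ) ^ (-(2 / q))) with hs
  have htsq : t ^ 2 = (m : ℝ) ^ (-(2 / q)) := by
    rw [ht, ← Real.rpow_natCast, ← Real.rpow_mul hm0.le]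
    congr 1
    push_cast
    ring
  have hle : (m : ℝ) ^ (-(2 / q)) ≤ 1 :=
    Real.rpow_le_one_of_one_le_of_nonpos hm' (by simp; positivity)
  have hst : s ^ 2 + t ^ 2 = 1 := by
    rw [hs, Real.sq_sqrt (by linarith), htsq]
    ring
  have hs1 : |s| ≤ 1 := by
    rw [← sq_le_one_iff_abs_le_one]
    nlinarith [sq_nonneg t]
  have ht0 : 0 ≤ t := by positivity
  subst hB
  refine ⟨spikeMatrix.lpnorm_two_row hst, spikeMatrix.opNormInf_eq_one hm hst,
    spikeMatrix.lpnorm_two_last_le_opNorm hs1, ?_, ?_⟩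
  · simp only [spikeMatrix.apply_last]
    rw [lpnorm_const two_pos, abs_of_nonneg ht0, ht, ← Real.rpow_add hm0, sub_eq_add_neg]
  · refine (spikeMatrix.opNorm_le hq hs1).trans_eq ?_
    rw [abs_of_nonneg ht0, ht, ← Real.rpow_add hm0, add_neg_cancel, Real.rpow_zero]
    norm_num
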